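/- Let K ≥ 3 be a natural number and y : Fin K → ℝ with S > 0. Then the normalized posterior density factors as a product of the marginal density of λ and the conditional density of μ given λ: for all μ ∈ ℝ and λ > 0, f(μ, λ) / (∫_0^∞ ∫_ℝ f(t, s) dt ds) = g₂(λ) · g₁(μ | λ), where g₁(μ | λ) = √(K/(2πλ)) exp(−K(μ − ȳ)²/(2λ)) is the N(ȳ, λ/K) density and g₂(λ) = ((S/2)^{(K−2)/2}/Γ((K−2)/2)) · λ^{−K/2} · exp(−S/(2λ)) is the Inverse-Gamma((K−2)/2, S/2) density. -/

import Mathlib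

open MeasureTheory Real Set

/-- The sum of squares about `m` splits into the centered sum of squares and the squared
distance of `m` from the mean. -/
lemma sum_sub_sq_eq_add_mul_sq {K : ℕ} (hK : K ≠ 0) (y : Fin K → ℝ) {ybar : ℝ}
    (hybar : ybar = (1 / (K : ℝ)) * ∑ j, y j) (m : ℝ) :
    ∑ j, (y j - m) ^ 2 = ∑ j, (y j - ybar) ^ 2 + K * (m - ybar) ^ 2 := by
  have hK' : (K : ℝ) ≠ 0 := Nat.cast_ne_zero.mpr hK
  have hsum : ∑ j, y j = K * ybar := by rw [hybar]; field_simp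
  have hexp : ∀ j, (y j - m) ^ 2 =
      (y j - ybar) ^ 2 + (2 * (ybar - m) * y j + (m ^ 2 - ybar ^ 2)) := fun j => by ring
  simp only [hexp, Finset.sum_add_distrib, ← Finset.mul_sum, hsum, Finset.sum_const,
    Finset.card_univ, Fintype.card_fin, nsmul_eq_mul]
  ring

/-- The density of the normal law with mean `m` and variance `l / k` has total mass one. -/
lemma integral_normal_density {k l : ℝ} (hk : 0 < k) (hl : 0 < l) (m : ℝ) :
    ∫ t : ℝ, √(k / (2 * π * l)) * exp (-(k * (t - m) ^ 2) / (2 * l)) = 1 := by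
  have h : ∀ t : ℝ, exp (-(k * (t - m) ^ 2) / (2 * l)) =
      (fun x : ℝ => exp (-(k / (2 * l)) * x ^ 2)) (t - m) := fun t => by
    simp only; congr 1; ring
  simp_rw [h]
  rw [integral_const_mul, integral_sub_right_eq_self (fun x : ℝ => exp (-(k / (2 * l)) * x ^ 2)) m,
    integral_gaussian, ← sqrt_mul (by positivity), sqrt_eq_one]
  field_simp

/-- The integral of the unnormalized Inverse-Gamma density. -/
lemma integral_rpow_mul_exp_neg_div_Ioi {a b : ℝ} (ha : 0 < a) (hb : 0 < b) :
    ∫ w in Ioi (0 : ℝ), w ^ (-(a + 1)) * exp (-(b / w)) = (1 / b) ^ a * Gamma a := by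
  rw [← integral_rpow_mul_exp_neg_mul_Ioi ha hb,
    ← integral_comp_rpow_Ioi (fun t : ℝ => t ^ (a - 1) * exp (-(b * t))) (p := -1) (by norm_num)]
  refine setIntegral_congr_fun measurableSet_Ioi fun w hw => ?_
  have hw : (0 : ℝ) < w := hw
  simp only [smul_eq_mul, abs_neg, abs_one, one_mul]
  rw [← rpow_mul hw.le, ← mul_assoc, ← rpow_add hw, rpow_neg_one, div_eq_mul_inv]
  congr 2
  ring

/-- For `K ≥ 3` and `S > 0`, the normalized posterior density
factors as the product of the Inverse-Gamma((K-2)/2, S/2) marginal density of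
`λ` and the N(ȳ, λ/K) conditional density of `μ` given `λ`. -/
theorem posterior_factors_marginal_times_conditional
    (K : ℕ) (hK : 3 ≤ K) (y : Fin K → ℝ)
    (ybar : ℝ) (hybar : ybar = (1 / (K : ℝ)) * ∑ j, y j)
    (S : ℝ) (hS : S = ∑ j, (y j - ybar) ^ 2) (hSpos : 0 < S)
    (f : ℝ → ℝ → ℝ)
    (hf : ∀ (μ l : ℝ),
      f μ l = l ^ (-(((K : ℝ) + 1) / 2)) *
        Real.exp (-(1 / (2 * l)) * ∑ j, (y j - μ) ^ 2))
    (g₁ : ℝ → ℝ → ℝ)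
    (hg₁ : ∀ (μ l : ℝ), g₁ μ l =
      Real.sqrt ((K : ℝ) / (2 * Real.pi * l)) *
        Real.exp (-((K : ℝ) * (μ - ybar) ^ 2) / (2 * l)))
    (g₂ : ℝ → ℝ)
    (hg₂ : ∀ l : ℝ, g₂ l =
      ((S / 2) ^ (((K : ℝ) - 2) / 2) / Real.Gamma (((K : ℝ) - 2) / 2)) *
        l ^ (-((K : ℝ) / 2)) * Real.exp (-S / (2 * l))) :
    ∀ (μ l : ℝ), 0 < l →
      f μ l / (∫ s in Set.Ioi (0 : ℝ), ∫ t : ℝ, f t s) = g₂ l * g₁ μ l := by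
  have hK0 : (0 : ℝ) < K := by positivity
  have hK3 : (3 : ℝ) ≤ K := by exact_mod_cast hK
  have ha : 0 < ((K : ℝ) - 2) / 2 := by linarith
  have hΓ := Gamma_pos_of_pos ha
  have hb : 0 < (S / 2) ^ (((K : ℝ) - 2) / 2) := rpow_pos_of_pos (by linarith) _
  have hg₁int : ∀ l : ℝ, 0 < l → ∫ t, g₁ t l = 1 := fun l hl => by
    simp only [hg₁]
    exact integral_normal_density hK0 hl ybar
  have hg₂int : ∫ l in Ioi (0 : ℝ), g₂ l = 1 := by
    have h := integral_rpow_mul_exp_neg_div_Ioi ha (half_pos hSpos)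
    have hg : ∀ l : ℝ, g₂ l = ((S / 2) ^ (((K : ℝ) - 2) / 2) / Gamma (((K : ℝ) - 2) / 2)) *
        (l ^ (-(((K : ℝ) - 2) / 2 + 1)) * exp (-(S / 2 / l))) := fun l => by
      rw [hg₂, mul_assoc]
      congr 3
      · ring
      · rw [div_div, neg_div]
    simp_rw [hg]
    rw [integral_const_mul, h, one_div, inv_rpow (half_pos hSpos).le]
    field_simp
  obtain ⟨C, hC, hfC⟩ : ∃ C : ℝ, 0 < C ∧ ∀ m l : ℝ, 0 < l → f m l = C * (g₂ l * g₁ m l) := by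
    refine ⟨√(2 * π / K) * (Gamma (((K : ℝ) - 2) / 2) / (S / 2) ^ (((K : ℝ) - 2) / 2)),
      by positivity, fun m l hl => ?_⟩
    have hsqrt : √(2 * π / K) * √(K / (2 * π * l)) = l ^ (-(1 / 2) : ℝ) := by
      rw [← sqrt_mul (by positivity), rpow_neg hl.le, ← sqrt_eq_rpow, ← sqrt_inv]
      congr 1
      field_simp
    have hpow : l ^ (-(((K : ℝ) + 1) / 2)) = l ^ (-((K : ℝ) / 2)) * l ^ (-(1 / 2) : ℝ) := by
      rw [← rpow_add hl]
      congr 1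
      ring
    have hexp : exp (-(1 / (2 * l)) * (S + K * (m - ybar) ^ 2)) =
        exp (-S / (2 * l)) * exp (-(K * (m - ybar) ^ 2) / (2 * l)) := by
      rw [← exp_add]
      congr 1
      ring
    rw [hf, sum_sub_sq_eq_add_mul_sq (by omega) y hybar, ← hS, hexp, hpow, ← hsqrt, hg₁, hg₂]
    field_simp
  have hint : ∫ s in Ioi (0 : ℝ), ∫ t, f t s = C := by
    calc ∫ s in Ioi (0 : ℝ), ∫ t, f t s = ∫ s in Ioi (0 : ℝ), C * g₂ s := by
          refine setIntegral_congr_fun measurableSet_Ioi fun s hs => ?_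
          simp only [hfC _ s hs, integral_const_mul, hg₁int s hs, mul_one]
      _ = C := by rw [integral_const_mul, hg₂int, mul_one]
  intro μ l hl
  rw [hint, hfC μ l hl, mul_div_cancel_left₀ _ hC.ne']
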